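/- Let h > 2 be an integer and let G be a finite simple graph with tw(G) ≥ (3/2)(3·2^h − 1) − 1. Then G contains as a minor some graph of the following form: the disjoint union of the complete binary tree B_h and a path P on 2^h vertices, together with the edges {l, φ(l)} for every leaf l of B_h, where φ : L(B_h) → V(P) is a bijection. -/

import Mathlib

/-- `IsMinor H G` : there is a minor model of `H` in `G`. -/
def IsMinor {α : Type*} {β : Type*} (H : SimpleGraph α) (G : SimpleGraph β) : Prop :=
  ∃ M : α → Set β,
    (∀ v, (G.induce (M v)).Connected) ∧
    (Pairwise fun u v => Disjoint (M u) (M v)) ∧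
    (∀ ⦃u v : α⦄, H.Adj u v → ∃ a ∈ M u, ∃ b ∈ M v, G.Adj a b)

/-- The treewidth of a finite simple graph: the least `w` such that `G` admits a tree
decomposition all of whose bags have at most `w + 1` vertices. -/
noncomputable def treewidth {V : Type*} [Fintype V] (G : SimpleGraph V) : ℕ :=
  sInf { w : ℕ | ∃ (ι : Type) (_ : Fintype ι) (t : SimpleGraph ι) (bag : ι → Finset V),
    t.IsTree ∧
    (∀ v : V, ∃ i, v ∈ bag i) ∧
    (∀ u v : V, G.Adj u v → ∃ i, u ∈ bag i ∧ v ∈ bag i) ∧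
    (∀ v : V, (t.induce {i : ι | v ∈ bag i}).Connected) ∧
    (∀ i, (bag i).card ≤ w + 1) }

/-- The disjoint union of the complete binary tree of height `h` (vertices indexed in
heap order by `Fin (2^(h+1) - 1)`, the node `a` having children `2a+1` and `2a+2`, so
the leaves are the nodes of index `≥ 2^h - 1`, the leaf of rank `j : Fin (2^h)` being
the node `2^h - 1 + j`) and a path on `2^h` vertices, together with an edge between
each leaf of rank `j` and the path vertex `ψ j`, where `ψ` is a bijection from the
leaves of the tree onto the vertices of the path. -/
def wheelHost (h : ℕ) (ψ : Fin (2 ^ h) ≃ Fin (2 ^ h)) :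
    SimpleGraph (Fin (2 ^ (h + 1) - 1) ⊕ Fin (2 ^ h)) :=
  SimpleGraph.fromRel (fun u v =>
    match u, v with
    | Sum.inl a, Sum.inl b => (b : ℕ) = 2 * (a : ℕ) + 1 ∨ (b : ℕ) = 2 * (a : ℕ) + 2
    | Sum.inr i, Sum.inr j => (j : ℕ) = (i : ℕ) + 1
    | Sum.inl a, Sum.inr i => ∃ j : Fin (2 ^ h), (a : ℕ) = 2 ^ h - 1 + (j : ℕ) ∧ ψ j = i
    | _, _ => False)

namespace SimpleGraph

section Connectivity

variable {V : Type*}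

/-- `P` is a nonempty vertex set inducing a connected subgraph of `G`, expressed by the absence
of proper nonempty subsets of `P` closed under adjacency. -/
def IsConnSet (G : SimpleGraph V) (P : Finset V) : Prop :=
  P.Nonempty ∧ ∀ U ⊆ P, U.Nonempty → (∀ u ∈ U, ∀ v ∈ P, G.Adj u v → v ∈ U) → P ⊆ U

/-- `(A, B)` is a separation of `G`: the two sides cover the vertices, and no edge joins
the complement of `B` to the complement of `A`. -/
def IsSeparation (G : SimpleGraph V) (A B : Finset V) : Prop :=
  (∀ v, v ∈ A ∨ v ∈ B) ∧ ∀ u v, u ∉ B → v ∉ A → ¬ G.Adj u v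

/-- The spanning subgraph of `G` formed by the edges with both ends in `C`. -/
def within (G : SimpleGraph V) (C : Finset V) : SimpleGraph V where
  Adj u v := G.Adj u v ∧ u ∈ C ∧ v ∈ C
  symm := ⟨fun _ _ h => ⟨h.1.symm, h.2.2, h.2.1⟩⟩
  loopless := ⟨fun _ h => G.irrefl h.1⟩

lemma within_le (G : SimpleGraph V) (C : Finset V) : G.within C ≤ G := fun _ _ h => h.1

lemma IsSeparation.symm {G : SimpleGraph V} {A B : Finset V} (h : G.IsSeparation A B) :
    G.IsSeparation B A :=
  ⟨fun v => (h.1 v).symm, fun u v hu hv huv => h.2 v u hv hu huv.symm⟩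

lemma IsConnSet.mono {G H : SimpleGraph V} (hGH : G ≤ H) {P : Finset V} (hP : G.IsConnSet P) :
    H.IsConnSet P :=
  ⟨hP.1, fun U hU hne hcl => hP.2 U hU hne fun u hu v hv huv => hcl u hu v hv (hGH huv)⟩

lemma isConnSet_singleton (G : SimpleGraph V) (v : V) : G.IsConnSet {v} := by
  refine ⟨⟨v, by simp⟩, fun U hU ⟨u, hu⟩ _ x hx => ?_⟩
  have h1 := Finset.mem_singleton.1 (hU hu)
  have h2 := Finset.mem_singleton.1 hx
  rwa [h2, ← h1]

lemma IsConnSet.connected {G : SimpleGraph V} {P : Finset V} (hP : G.IsConnSet P) :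
    (G.induce (P : Set V)).Connected := by
  classical
  obtain ⟨⟨x, hx⟩, hcl⟩ := hP
  have key : ∀ y (hy : y ∈ P), (G.induce (P : Set V)).Reachable ⟨x, hx⟩ ⟨y, hy⟩ := by
    have := hcl (P.filter fun y => ∃ hy : y ∈ P,
      (G.induce (P : Set V)).Reachable ⟨x, hx⟩ ⟨y, hy⟩) (Finset.filter_subset _ _)
      ⟨x, by simp [hx]⟩ ?_
    · intro y hy
      exact (Finset.mem_filter.1 (this hy)).2.2
    · intro u hu v hv huv
      obtain ⟨-, hu, hr⟩ := Finset.mem_filter.1 hu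
      refine Finset.mem_filter.2 ⟨hv, hv, hr.trans (Adj.reachable ?_)⟩
      exact huv
  rw [connected_iff]
  exact ⟨fun a b => (key a a.2).symm.trans (key b b.2), ⟨⟨x, hx⟩⟩⟩

variable [DecidableEq V]

lemma IsConnSet.union {G : SimpleGraph V} {P Q : Finset V} (hP : G.IsConnSet P)
    (hQ : G.IsConnSet Q) {a b : V} (ha : a ∈ P) (hb : b ∈ Q) (hab : a = b ∨ G.Adj a b) :
    G.IsConnSet (P ∪ Q) := by
  refine ⟨⟨a, by simp [ha]⟩, fun U hU hne hcl => ?_⟩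
  have hPU : (U ∩ P).Nonempty → P ⊆ U := fun h =>
    (hP.2 (U ∩ P) Finset.inter_subset_right h (fun u hu v hv huv => by
      simp only [Finset.mem_inter] at hu ⊢
      exact ⟨hcl u hu.1 v (by simp [hv]) huv, hv⟩)).trans Finset.inter_subset_left
  have hQU : (U ∩ Q).Nonempty → Q ⊆ U := fun h =>
    (hQ.2 (U ∩ Q) Finset.inter_subset_right h (fun u hu v hv huv => by
      simp only [Finset.mem_inter] at hu ⊢
      exact ⟨hcl u hu.1 v (by simp [hv]) huv, hv⟩)).trans Finset.inter_subset_left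
  have hPQ : P ⊆ U → Q ⊆ U := fun h => hQU ⟨b, by
    have : b ∈ U := by
      rcases hab with rfl | hab
      · exact h ha
      · exact hcl a (h ha) b (by simp [hb]) hab
    simp [hb, this]⟩
  have hQP : Q ⊆ U → P ⊆ U := fun h => hPU ⟨a, by
    have : a ∈ U := by
      rcases hab with rfl | hab
      · exact h hb
      · exact hcl b (h hb) a (by simp [ha]) hab.symm
    simp [ha, this]⟩
  obtain ⟨u, hu⟩ := hne
  rcases Finset.mem_union.1 (hU hu) with h | h
  · have := hPU ⟨u, by simp [hu, h]⟩
    exact Finset.union_subset this (hPQ this)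
  · have := hQU ⟨u, by simp [hu, h]⟩
    exact Finset.union_subset (hQP this) this

lemma IsConnSet.exists_mem_inter {G : SimpleGraph V} {A B P : Finset V} (hP : G.IsConnSet P)
    (hAB : G.IsSeparation A B) {a b : V} (ha : a ∈ P) (haA : a ∈ A) (hb : b ∈ P) (hbB : b ∈ B) :
    ∃ v ∈ P, v ∈ A ∧ v ∈ B := by
  by_contra! hcon
  have := hP.2 (P ∩ A) Finset.inter_subset_left ⟨a, by simp [ha, haA]⟩ ?_ hb
  · exact hcon b hb (Finset.mem_inter.1 this).2 hbB
  · intro u hu v hv huv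
    simp only [Finset.mem_inter] at hu ⊢
    refine ⟨hv, ?_⟩
    by_contra hvA
    exact hAB.2 u v (hcon u hu.1 hu.2) hvA huv

lemma IsConnSet.subset_of_within {G : SimpleGraph V} {C P : Finset V}
    (hP : (G.within C).IsConnSet P) {a : V} (ha : a ∈ P) (haC : a ∈ C) : P ⊆ C := by
  refine (hP.2 (P ∩ C) Finset.inter_subset_left ⟨a, by simp [ha, haC]⟩ ?_).trans
    Finset.inter_subset_right
  intro u _ v hv huv
  exact Finset.mem_inter.2 ⟨hv, huv.2.2⟩

/-- Inside a connected set, a vertex `x` can be connected up to a neighbour of `y`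
without using `y`. -/
lemma IsConnSet.exists_subset_adj {G : SimpleGraph V} {P : Finset V} (hP : G.IsConnSet P)
    {x y : V} (hx : x ∈ P) (hy : y ∈ P) (hxy : x ≠ y) :
    ∃ K ⊆ P, y ∉ K ∧ x ∈ K ∧ G.IsConnSet K ∧ ∃ z ∈ K, G.Adj z y := by
  classical
  have hne : (P.powerset.filter fun K => y ∉ K ∧ x ∈ K ∧ G.IsConnSet K).Nonempty :=
    ⟨{x}, by simp [hx, Ne.symm hxy, isConnSet_singleton]⟩
  obtain ⟨K, hK, hmax⟩ := Finset.exists_max_image _ Finset.card hne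
  simp only [Finset.mem_filter, Finset.mem_powerset] at hK hmax
  obtain ⟨hKP, hyK, hxK, hKc⟩ := hK
  refine ⟨K, hKP, hyK, hxK, hKc, ?_⟩
  by_contra! hcon
  refine hyK (hP.2 K hKP ⟨x, hxK⟩ ?_ hy)
  intro u hu v hv huv
  by_contra hvK
  have hvy : v ≠ y := fun h => hcon u hu (h ▸ huv)
  have := hmax (K ∪ {v}) ⟨Finset.union_subset hKP (by simpa using hv), by simp [hyK, hvy.symm],
    by simp [hxK], hKc.union (isConnSet_singleton G v) hu (by simp) (Or.inr huv)⟩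
  rw [Finset.card_union_of_disjoint (by simpa using hvK)] at this
  simp at this

/-- If `k` disjoint sets all meet a set `X` with at most `k` elements, then each of them meets it
exactly once and together they cover it. -/
lemma transversal_of_card_le {k : ℕ} {P : Fin k → Finset V} {X : Finset V}
    (hd : Pairwise fun i j => Disjoint (P i) (P j)) (hX : ∀ i, ∃ v ∈ P i, v ∈ X)
    (hk : X.card ≤ k) :
    (∀ z ∈ X, ∃ i, z ∈ P i) ∧ ∀ i, ∀ u ∈ P i, ∀ v ∈ P i, u ∈ X → v ∈ X → u = v := by
  choose a haP haX using hX
  have hinj : Function.Injective a := by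
    intro i j hij
    by_contra hne
    exact Finset.disjoint_left.1 (hd hne) (haP i) (hij ▸ haP j)
  have himg : Finset.univ.image a = X := by
    apply Finset.eq_of_subset_of_card_le
    · intro v hv
      obtain ⟨i, -, rfl⟩ := Finset.mem_image.1 hv
      exact haX i
    · rw [Finset.card_image_of_injective _ hinj]
      simpa using hk
  have hall : ∀ z ∈ X, ∃ i, a i = z := by
    intro z hz
    rw [← himg] at hz
    simpa using hz
  have huniq : ∀ i, ∀ u ∈ P i, u ∈ X → u = a i := by
    intro i u hu huX
    obtain ⟨j, rfl⟩ := hall u huX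
    by_cases hij : i = j
    · rw [hij]
    · exact absurd (haP j) (Finset.disjoint_left.1 (hd hij) hu)
  refine ⟨fun z hz => ?_, fun i u hu v hv huX hvX => ?_⟩
  · obtain ⟨i, rfl⟩ := hall z hz
    exact ⟨i, haP i⟩
  · rw [huniq i u hu huX, huniq i v hv hvX]

/-- Gluing two linkages along the two sides of a separation of order less than `k`, crossed by the
single edge `xy`. -/
lemma exists_linkage_of_halves {G : SimpleGraph V} {k : ℕ} {S T C D : Finset V} {x y : V}
    (hxy : G.Adj x y) (hyC : y ∉ C) (hcard : (C ∩ D).card < k)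
    (hSC : S ⊆ C) (hTD : T ⊆ D)
    {P Q : Fin k → Finset V}
    (hPd : Pairwise fun i j => Disjoint (P i) (P j))
    (hPc : ∀ i, (G.within C).IsConnSet (P i))
    (hPS : ∀ i, ∃ v ∈ P i, v ∈ S) (hPX : ∀ i, ∃ v ∈ P i, v ∈ insert x (C ∩ D))
    (hQd : Pairwise fun i j => Disjoint (Q i) (Q j))
    (hQc : ∀ i, (G.within D).IsConnSet (Q i))
    (hQX : ∀ i, ∃ v ∈ Q i, v ∈ insert y (C ∩ D)) (hQT : ∀ i, ∃ v ∈ Q i, v ∈ T) :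
    ∃ R : Fin k → Finset V, (Pairwise fun i j => Disjoint (R i) (R j)) ∧
      (∀ i, G.IsConnSet (R i)) ∧ (∀ i, ∃ v ∈ R i, v ∈ S) ∧ ∀ i, ∃ v ∈ R i, v ∈ T := by
  have hPC : ∀ i, P i ⊆ C := fun i => by
    obtain ⟨v, hv, hvS⟩ := hPS i
    exact (hPc i).subset_of_within hv (hSC hvS)
  have hQD : ∀ i, Q i ⊆ D := fun i => by
    obtain ⟨v, hv, hvT⟩ := hQT i
    exact (hQc i).subset_of_within hv (hTD hvT)
  obtain ⟨-, hPu⟩ := transversal_of_card_le hPd hPX ((Finset.card_insert_le _ _).trans hcard)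
  obtain ⟨hQa, hQu⟩ := transversal_of_card_le hQd hQX ((Finset.card_insert_le _ _).trans hcard)
  choose a haP haX using hPX
  have hσ : ∀ i, ∃ j, ∃ b, b ∈ Q j ∧ b ∈ insert y (C ∩ D) ∧
      ((a i = x ∧ b = y) ∨ (a i = b ∧ b ∈ C ∩ D)) := by
    intro i
    rcases Finset.mem_insert.1 (haX i) with h | h
    · obtain ⟨j, hj⟩ := hQa y (by simp)
      exact ⟨j, y, hj, by simp, Or.inl ⟨h, rfl⟩⟩
    · obtain ⟨j, hj⟩ := hQa (a i) (Finset.mem_insert_of_mem h)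
      exact ⟨j, a i, hj, Finset.mem_insert_of_mem h, Or.inr ⟨rfl, h⟩⟩
  choose g b hbQ hbX hab using hσ
  have hainj : ∀ i j, a i = a j → i = j := by
    intro i j h
    by_contra hne
    exact Finset.disjoint_left.1 (hPd hne) (haP i) (h ▸ haP j)
  have hbinj : ∀ i j, b i = b j → i = j := by
    intro i j h
    apply hainj
    have hyCD : y ∉ C ∩ D := fun h => hyC (Finset.mem_inter.1 h).1
    rcases hab i with ⟨h1, h2⟩ | ⟨h1, h2⟩ <;> rcases hab j with ⟨h3, h4⟩ | ⟨h3, h4⟩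
    · rw [h1, h3]
    · exact absurd (h2 ▸ h ▸ h4) hyCD
    · exact absurd (h4 ▸ h ▸ h2) hyCD
    · rw [h1, h3, h]
  have hginj : ∀ i j, g i = g j → i = j := fun i j h =>
    hbinj i j (hQu (g i) _ (hbQ i) _ (h ▸ hbQ j) (hbX i) (hbX j))
  have hcross : ∀ i j v, v ∈ P i → v ∈ Q (g j) → i = j := by
    intro i j v hvP hvQ
    have hvCD : v ∈ C ∩ D := Finset.mem_inter.2 ⟨hPC i hvP, hQD _ hvQ⟩
    have h1 : v = a i := hPu i _ hvP _ (haP i) (Finset.mem_insert_of_mem hvCD) (haX i)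
    have h2 : v = b j := hQu _ _ hvQ _ (hbQ j) (Finset.mem_insert_of_mem hvCD) (hbX j)
    rcases hab j with ⟨-, h3⟩ | ⟨h3, -⟩
    · rw [h2, h3] at hvCD
      exact absurd (Finset.mem_inter.1 hvCD).1 hyC
    · exact hainj i j (by rw [← h1, h2, h3])
  refine ⟨fun i => P i ∪ Q (g i), fun i j hij => ?_, fun i => ?_, fun i => ?_, fun i => ?_⟩
  · refine Finset.disjoint_left.2 fun v hv hv' => ?_
    rcases Finset.mem_union.1 hv with h | h <;> rcases Finset.mem_union.1 hv' with h' | h'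
    · exact Finset.disjoint_left.1 (hPd hij) h h'
    · exact hij (hcross i j v h h')
    · exact hij (hcross j i v h' h).symm
    · exact Finset.disjoint_left.1 (hQd fun h => hij (hginj i j h)) h h'
  · refine ((hPc i).mono (within_le _ _)).union ((hQc (g i)).mono (within_le _ _))
      (haP i) (hbQ i) ?_
    rcases hab i with ⟨h1, h2⟩ | ⟨h1, -⟩
    · exact Or.inr (by rw [h1, h2]; exact hxy)
    · exact Or.inl h1
  · obtain ⟨v, hv, hvS⟩ := hPS i
    exact ⟨v, Finset.mem_union_left _ hv, hvS⟩
  · obtain ⟨v, hv, hvT⟩ := hQT (g i)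
    exact ⟨v, Finset.mem_union_right _ hv, hvT⟩

end Connectivity

section Menger

variable {V : Type*} [Fintype V] [DecidableEq V]

/-- **Menger's theorem**: if every separation of `G` with `S` on one side and `T` on the other has
order at least `k`, then there are `k` disjoint connected sets meeting both `S` and `T`. -/
theorem menger (k : ℕ) (G : SimpleGraph V) (S T : Finset V)
    (hk : ∀ C D, G.IsSeparation C D → S ⊆ C → T ⊆ D → k ≤ (C ∩ D).card) :
    ∃ P : Fin k → Finset V, (Pairwise fun i j => Disjoint (P i) (P j)) ∧
      (∀ i, G.IsConnSet (P i)) ∧ (∀ i, ∃ v ∈ P i, v ∈ S) ∧ ∀ i, ∃ v ∈ P i, v ∈ T := by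
  induction G using WellFoundedLT.induction generalizing S T with
  | ind G ih =>
  by_cases hE : ∃ x y, G.Adj x y
  · obtain ⟨x, y, hxy⟩ := hE
    have hlt : G.deleteEdges {s(x, y)} < G := by
      refine lt_of_le_of_ne (deleteEdges_le _) fun h => ?_
      have := h ▸ hxy
      simp [deleteEdges_adj] at this
    by_cases hdel : ∀ C D, (G.deleteEdges {s(x, y)}).IsSeparation C D → S ⊆ C → T ⊆ D →
        k ≤ (C ∩ D).card
    · obtain ⟨P, h1, h2, h3, h4⟩ := ih _ hlt S T hdel
      exact ⟨P, h1, fun i => (h2 i).mono hlt.le, h3, h4⟩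
    push Not at hdel
    obtain ⟨C, D, hCD, hSC, hTD, hcard⟩ := hdel
    obtain ⟨x', y', hxy', hxD, hyC, hends⟩ : ∃ x' y', G.Adj x' y' ∧ x' ∉ D ∧ y' ∉ C ∧
        ∀ u v, u ∉ D → v ∉ C → G.Adj u v → u = x' ∧ v = y' := by
      have hnot : ¬ G.IsSeparation C D := fun h => absurd (hk C D h hSC hTD) (by omega)
      have : ∃ u v, u ∉ D ∧ v ∉ C ∧ G.Adj u v := by
        by_contra! hcon
        exact hnot ⟨hCD.1, hcon⟩
      obtain ⟨u, v, hu, hv, huv⟩ := this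
      refine ⟨u, v, huv, hu, hv, fun u' v' hu' hv' huv' => ?_⟩
      have e1 := hCD.2 u v hu hv
      have e2 := hCD.2 u' v' hu' hv'
      have c1 := hCD.1 u
      have c2 := hCD.1 v
      have c3 := hCD.1 u'
      have c4 := hCD.1 v'
      simp only [deleteEdges_adj, huv, huv', Set.mem_singleton_iff, true_and, not_not] at e1 e2
      rw [Sym2.eq_iff] at e1 e2
      grind
    have hC : ∀ C' D', (G.within C).IsSeparation C' D' → S ⊆ C' → insert x' (C ∩ D) ⊆ D' →
        k ≤ (C' ∩ D').card := by
      intro C' D' hs hS' hX'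
      refine (hk (C ∩ C') (D ∪ D') ⟨fun v => ?_, fun u v hu hv huv => ?_⟩
        (Finset.subset_inter hSC hS') (hTD.trans Finset.subset_union_left)).trans
        (Finset.card_le_card fun v hv => ?_)
      · have := hCD.1 v
        have := hs.1 v
        simp only [Finset.mem_inter, Finset.mem_union]
        tauto
      · simp only [Finset.mem_inter, Finset.mem_union, not_or, not_and] at hu hv
        have huC : u ∈ C := (hCD.1 u).resolve_right hu.1
        have hvC : v ∈ C := by
          by_contra hvC
          have := (hends u v hu.1 hvC huv).1
          exact hu.2 (hX' (by simp [this]))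
        exact hs.2 u v hu.2 (hv hvC) ⟨huv, huC, hvC⟩
      · have := @hX' v
        simp only [Finset.mem_inter, Finset.mem_union, Finset.mem_insert] at hv this ⊢
        tauto
    have hD : ∀ C' D', (G.within D).IsSeparation C' D' → insert y' (C ∩ D) ⊆ C' → T ⊆ D' →
        k ≤ (C' ∩ D').card := by
      intro C' D' hs hX' hT'
      refine (hk (C ∪ C') (D ∩ D') ⟨fun v => ?_, fun u v hu hv huv => ?_⟩
        (hSC.trans Finset.subset_union_left) (Finset.subset_inter hTD hT')).trans
        (Finset.card_le_card fun v hv => ?_)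
      · have := hCD.1 v
        have := hs.1 v
        simp only [Finset.mem_inter, Finset.mem_union]
        tauto
      · simp only [Finset.mem_inter, Finset.mem_union, not_or, not_and] at hu hv
        have hvD : v ∈ D := (hCD.1 v).resolve_left hv.1
        have huD : u ∈ D := by
          by_contra huD
          have := (hends u v huD hv.1 huv).2
          exact hv.2 (hX' (by simp [this]))
        exact hs.2 u v (hu huD) hv.2 ⟨huv, huD, hvD⟩
      · have := @hX' v
        simp only [Finset.mem_inter, Finset.mem_union, Finset.mem_insert] at hv this ⊢
        tauto
    have hltC : G.within C < G := lt_of_le_of_ne (within_le _ _) fun h =>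
      hyC (h.ge hxy').2.2
    have hltD : G.within D < G := lt_of_le_of_ne (within_le _ _) fun h =>
      hxD (h.ge hxy').2.1
    obtain ⟨P, hP1, hP2, hP3, hP4⟩ := ih _ hltC _ _ hC
    obtain ⟨Q, hQ1, hQ2, hQ3, hQ4⟩ := ih _ hltD _ _ hD
    exact exists_linkage_of_halves hxy' hyC hcard hSC hTD hP1 hP2 hP3 hP4 hQ1 hQ2 hQ3 hQ4
  · push Not at hE
    have hST : k ≤ (S ∩ T).card := by
      refine (hk S (Sᶜ ∪ T) ⟨fun v => ?_, fun u v _ _ => hE u v⟩ subset_rfl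
        Finset.subset_union_right).trans (Finset.card_le_card fun v hv => ?_)
      · simp only [Finset.mem_union, Finset.mem_compl]
        tauto
      · simp only [Finset.mem_inter, Finset.mem_union, Finset.mem_compl] at hv ⊢
        tauto
    obtain ⟨W, hW, hWk⟩ := Finset.exists_subset_card_eq hST
    let e := W.equivFinOfCardEq hWk
    have hmem : ∀ i, (e.symm i : V) ∈ S ∩ T := fun i => hW (e.symm i).2
    refine ⟨fun i => {(e.symm i : V)}, fun i j hij => ?_, fun i => isConnSet_singleton _ _,
      fun i => ⟨_, by simp, (Finset.mem_inter.1 (hmem i)).1⟩,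
      fun i => ⟨_, by simp, (Finset.mem_inter.1 (hmem i)).2⟩⟩
    simpa [Subtype.ext_iff.symm] using hij

end Menger

section TreeDecomposition

variable {V : Type*} [DecidableEq V]

/-- `A` is the small side of the separation `(A, B)`: the graph induced on `A` has a rooted tree
decomposition whose root bag contains `A ∩ B`, in which each part is either a bag with at most
`m` vertices or the first side of a separation from the list `L`. -/
inductive IsSmallSide (G : SimpleGraph V) (m : ℕ) (L : Set (Finset V × Finset V)) :
    Finset V → Finset V → Prop
  | leaf {A B : Finset V} : (A, B) ∈ L → G.IsSeparation A B → IsSmallSide G m L A B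
  | bag {A B : Finset V} : G.IsSeparation A B → A.card ≤ m → IsSmallSide G m L A B
  | join {A B A₁ B₁ A₂ B₂ : Finset V} : IsSmallSide G m L A₁ B₁ → IsSmallSide G m L A₂ B₂ →
      G.IsSeparation A B → A₁ ⊆ A → A₂ ⊆ A → B ⊆ B₁ → B ⊆ B₂ → A₁ ⊆ B₂ → A₂ ⊆ B₁ →
      (B₁ ∩ B₂ ∩ A).card ≤ m → IsSmallSide G m L A B

lemma IsSmallSide.isSeparation {G : SimpleGraph V} {m : ℕ} {L : Set (Finset V × Finset V)}
    {A B : Finset V} (h : G.IsSmallSide m L A B) : G.IsSeparation A B := by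
  cases h <;> assumption

lemma IsConnSet.map {ι κ : Type*} {t : SimpleGraph ι} {t' : SimpleGraph κ} (f : ι ↪ κ)
    (hf : ∀ a b, t.Adj a b → t'.Adj (f a) (f b)) {P : Finset ι} (hP : t.IsConnSet P) :
    t'.IsConnSet (P.map f) := by
  classical
  refine ⟨hP.1.map, fun U hU hne hcl => ?_⟩
  have key := hP.2 (P.filter fun i => f i ∈ U) (Finset.filter_subset _ _) ?_ ?_
  · intro x hx
    obtain ⟨i, hi, rfl⟩ := Finset.mem_map.1 hx
    exact (Finset.mem_filter.1 (key hi)).2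
  · obtain ⟨x, hx⟩ := hne
    obtain ⟨i, hi, rfl⟩ := Finset.mem_map.1 (hU hx)
    exact ⟨i, Finset.mem_filter.2 ⟨hi, hx⟩⟩
  · intro i hi j hj hij
    exact Finset.mem_filter.2 ⟨hj, hcl _ (Finset.mem_filter.1 hi).2 _
      (Finset.mem_map_of_mem f hj) (hf i j hij)⟩

lemma IsTree.sum_sup_edge {ι κ : Type*} [Finite ι] [Finite κ] {t : SimpleGraph ι}
    {t' : SimpleGraph κ} (ht : t.IsTree) (ht' : t'.IsTree) (r : ι) (r' : κ) :
    (t.sum t' ⊔ edge (.inl r) (.inr r')).IsTree := by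
  have hc := Connected.sum_sup_edge (v := r) (w := r') ht.connected ht'.connected
  refine isTree_iff_connected_and_card.2 ⟨hc, le_antisymm ?_ hc.card_vert_le_card_edgeSet_add_one⟩
  have h1 := (isTree_iff_connected_and_card.1 ht).2
  have h2 := (isTree_iff_connected_and_card.1 ht').2
  have h3 : Nat.card (t.sum t').edgeSet = Nat.card t.edgeSet + Nat.card t'.edgeSet := by
    rw [Nat.card_congr edgeSetSumEquiv, Nat.card_sum]
  have h4 : Nat.card (t.sum t' ⊔ edge (.inl r) (.inr r')).edgeSet ≤
      Nat.card (t.sum t').edgeSet + 1 := by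
    simp only [Nat.card_coe_set_eq]
    rw [edgeSet_sup]
    refine (Set.ncard_union_le _ _).trans (Nat.add_le_add_left ?_ _)
    exact (Set.ncard_le_ncard edgeSet_edge_subset).trans (by simp)
  rw [Nat.card_sum]
  omega

/-- The subgraph of `G` induced on `A` has a tree decomposition with bags of size at most `m`
and with root bag `S`. -/
def HasRootedTreeDecomposition (G : SimpleGraph V) (m : ℕ) (A S : Finset V) : Prop :=
  ∃ (ι : Type) (_ : Fintype ι) (t : SimpleGraph ι) (bag : ι → Finset V) (r : ι),
    t.IsTree ∧ (∀ i, bag i ⊆ A) ∧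
    (∀ v ∈ A, t.IsConnSet (Finset.univ.filter fun i => v ∈ bag i)) ∧
    (∀ u ∈ A, ∀ v ∈ A, G.Adj u v → ∃ i, u ∈ bag i ∧ v ∈ bag i) ∧
    (∀ i, (bag i).card ≤ m) ∧ bag r = S

lemma hasRootedTreeDecomposition_self (G : SimpleGraph V) {m : ℕ} {A : Finset V}
    (hA : A.card ≤ m) : G.HasRootedTreeDecomposition m A A := by
  refine ⟨Unit, inferInstance, ⊥, fun _ => A, (), IsTree.of_subsingleton, fun _ => subset_rfl,
    fun v hv => ?_, fun u hu v hv _ => ⟨(), hu, hv⟩, fun _ => hA, rfl⟩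
  convert isConnSet_singleton (⊥ : SimpleGraph Unit) ()
  ext
  simp [hv]

lemma HasRootedTreeDecomposition.union {G : SimpleGraph V} {m : ℕ} {A A' S S' : Finset V}
    (h : G.HasRootedTreeDecomposition m A S) (h' : G.HasRootedTreeDecomposition m A' S')
    (hS : A ∩ A' ⊆ S) (hS' : A ∩ A' ⊆ S')
    (hadj : ∀ u ∈ A, ∀ v ∈ A', u ∉ A' → v ∉ A → ¬ G.Adj u v) :
    G.HasRootedTreeDecomposition m (A ∪ A') S' := by
  classical
  obtain ⟨ι, _, t, bag, r, ht, hsub, hconn, hedge, hcard, rfl⟩ := h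
  obtain ⟨ι', _, t', bag', r', ht', hsub', hconn', hedge', hcard', rfl⟩ := h'
  have hfilter : ∀ v, (Finset.univ.filter fun i => v ∈ Sum.elim bag bag' i) =
      (Finset.univ.filter fun i => v ∈ bag i).map Function.Embedding.inl ∪
      (Finset.univ.filter fun i => v ∈ bag' i).map Function.Embedding.inr := by
    intro v
    ext (i | i) <;> simp
  refine ⟨ι ⊕ ι', inferInstance, _, Sum.elim bag bag', .inr r', ht.sum_sup_edge ht' r r',
    ?_, ?_, ?_, ?_, rfl⟩
  · rintro (i | i)
    · exact (hsub i).trans Finset.subset_union_left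
    · exact (hsub' i).trans Finset.subset_union_right
  · intro v hv
    rw [hfilter]
    have hl : v ∈ A → (t.sum t' ⊔ edge (.inl r) (.inr r')).IsConnSet
        ((Finset.univ.filter fun i => v ∈ bag i).map Function.Embedding.inl) := fun hv =>
      (hconn v hv).map _ fun a b hab => by simp [hab]
    have hr : v ∈ A' → (t.sum t' ⊔ edge (.inl r) (.inr r')).IsConnSet
        ((Finset.univ.filter fun i => v ∈ bag' i).map Function.Embedding.inr) := fun hv =>
      (hconn' v hv).map _ fun a b hab => by simp [hab]
    by_cases h1 : v ∈ A <;> by_cases h2 : v ∈ A'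
    · have hv' := Finset.mem_inter.2 ⟨h1, h2⟩
      refine (hl h1).union (hr h2) (a := .inl r) (b := .inr r') ?_ ?_ (Or.inr ?_)
      · simpa using hS hv'
      · simpa using hS' hv'
      · simp [edge]
    · rw [Finset.filter_false_of_mem (s := (Finset.univ : Finset ι')) fun i _ hi => h2 (hsub' i hi)]
      simpa using hl h1
    · rw [Finset.filter_false_of_mem (s := (Finset.univ : Finset ι)) fun i _ hi => h1 (hsub i hi)]
      simpa using hr h2
    · simp [h1, h2] at hv
  · have hl : ∀ u ∈ A, ∀ v ∈ A, G.Adj u v → ∃ i, u ∈ Sum.elim bag bag' i ∧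
        v ∈ Sum.elim bag bag' i := fun u hu v hv huv => by
      obtain ⟨i, hi⟩ := hedge u hu v hv huv
      exact ⟨.inl i, hi⟩
    have hr : ∀ u ∈ A', ∀ v ∈ A', G.Adj u v → ∃ i, u ∈ Sum.elim bag bag' i ∧
        v ∈ Sum.elim bag bag' i := fun u hu v hv huv => by
      obtain ⟨i, hi⟩ := hedge' u hu v hv huv
      exact ⟨.inr i, hi⟩
    intro u hu v hv huv
    have h1 := hadj u
    have h2 := hadj v
    have h3 := huv.symm
    simp only [Finset.mem_union] at hu hv
    by_cases a1 : u ∈ A <;> by_cases a2 : v ∈ A <;> by_cases a3 : u ∈ A' <;>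
      by_cases a4 : v ∈ A' <;> grind
  · rintro (i | i)
    · exact hcard i
    · exact hcard' i

lemma IsSmallSide.hasRootedTreeDecomposition {G : SimpleGraph V} {m : ℕ} {A B : Finset V}
    (h : G.IsSmallSide m ∅ A B) : ∃ S, A ∩ B ⊆ S ∧ G.HasRootedTreeDecomposition m A S := by
  induction h with
  | leaf h => exact h.elim
  | @bag A B _ hA => exact ⟨A, Finset.inter_subset_left, hasRootedTreeDecomposition_self G hA⟩
  | @join A B A₁ B₁ A₂ B₂ h₁ h₂ _ hA₁ hA₂ hB₁ hB₂ h12 h21 hcard ih₁ ih₂ =>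
    obtain ⟨S₁, hS₁, t₁⟩ := ih₁
    obtain ⟨S₂, hS₂, t₂⟩ := ih₂
    have s₁ := h₁.isSeparation
    have s₂ := h₂.isSeparation
    have key := t₂.union (t₁.union (hasRootedTreeDecomposition_self G hcard) ?_ ?_ ?_) ?_ ?_ ?_
    · refine ⟨B₁ ∩ B₂ ∩ A, fun v hv => ?_, ?_⟩
      · simp only [Finset.mem_inter] at hv ⊢
        exact ⟨⟨hB₁ hv.2, hB₂ hv.2⟩, hv.1⟩
      · convert key using 1
        ext v
        have a1 := s₁.1 v
        have a2 := s₂.1 v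
        have a3 := @hA₁ v
        have a4 := @hA₂ v
        simp only [Finset.mem_union, Finset.mem_inter]
        tauto
    · intro v hv
      simp only [Finset.mem_inter] at hv
      exact hS₁ (Finset.mem_inter.2 ⟨hv.1, hv.2.1.1⟩)
    · exact Finset.inter_subset_right
    · intro u hu v hv hu' hv'
      refine s₁.2 u v (fun hB => hu' ?_) hv'
      simp only [Finset.mem_inter]
      exact ⟨⟨hB, h12 hu⟩, hA₁ hu⟩
    · intro v hv
      simp only [Finset.mem_inter, Finset.mem_union] at hv
      have := @h12 v
      exact hS₂ (Finset.mem_inter.2 ⟨hv.1, by tauto⟩)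
    · intro v hv
      have a1 := @h12 v
      have a2 := @h21 v
      have a3 := @hA₂ v
      simp only [Finset.mem_inter, Finset.mem_union] at hv ⊢
      tauto
    · intro u hu v hv hu' hv'
      refine s₂.2 u v (fun hB => hu' ?_) hv'
      have a1 := @h21 u hu
      have a2 := @hA₂ u hu
      simp only [Finset.mem_inter, Finset.mem_union]
      tauto

end TreeDecomposition

section Orientation

variable {V : Type*} [DecidableEq V]

/-- The vertices of `A ∩ B` are linked to `A' ∩ B'` by disjoint connected sets inside
`B ∩ A'`. -/
def IsLinked (G : SimpleGraph V) (A B A' B' : Finset V) : Prop :=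
  ∃ P : V → Finset V, (∀ s ∈ A ∩ B, s ∈ P s ∧ G.IsConnSet (P s) ∧ P s ⊆ B ∩ A' ∧
      (∀ v ∈ P s, v ∈ A → v = s) ∧ ∃ v ∈ P s, v ∈ A' ∩ B') ∧
    ∀ s ∈ A ∩ B, ∀ t ∈ A ∩ B, s ≠ t → Disjoint (P s) (P t)

lemma isLinked_of_forall_card_le [Fintype V] {G : SimpleGraph V} {A B A' B' : Finset V}
    (hs : G.IsSeparation A B) (hs' : G.IsSeparation A' B') (hA : A ⊆ A') (hB : B' ⊆ B)
    (hmin : ∀ C D, G.IsSeparation C D → A ⊆ C → C ⊆ A' → B' ⊆ D → D ⊆ B →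
      (A ∩ B).card ≤ (C ∩ D).card) : G.IsLinked A B A' B' := by
  have hmenger : ∀ P Q, (G.within (B ∩ A')).IsSeparation P Q → A ∩ B ⊆ P → A' ∩ B' ⊆ Q →
      (A ∩ B).card ≤ (P ∩ Q).card := by
    intro P Q hPQ hP hQ
    have hsub : ((A ∪ P) ∩ A') ∩ ((B' ∪ Q) ∩ B) ⊆ P ∩ Q := by
      intro v hv
      have h1 := @hP v
      have h2 := @hQ v
      simp only [Finset.mem_inter, Finset.mem_union] at hv h1 h2 ⊢
      tauto
    refine (hmin _ _ ⟨fun v => ?_, fun u v hu hv huv => ?_⟩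
      (Finset.subset_inter Finset.subset_union_left hA) Finset.inter_subset_right
      (Finset.subset_inter Finset.subset_union_left hB) Finset.inter_subset_right).trans
      (Finset.card_le_card hsub)
    · have h1 := hs.1 v
      have h2 := hs'.1 v
      have h3 := hPQ.1 v
      have h4 := @hA v
      have h5 := @hB v
      simp only [Finset.mem_inter, Finset.mem_union]
      tauto
    · simp only [Finset.mem_inter, Finset.mem_union, not_and_or, not_or] at hu hv
      have huB : u ∈ B := by
        by_contra huB
        exact hs.2 u v huB (fun hvA => hv.elim (fun h => h.1 hvA) fun h => h (hA hvA)) huv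
      have hvA' : v ∈ A' := by
        by_contra hvA'
        exact hs'.2 u v (fun huB' => hu.elim (fun h => h.1 huB') fun h => h huB) hvA' huv
      have hu' := hu.resolve_right (not_not.2 huB)
      have hv' := hv.resolve_right (not_not.2 hvA')
      exact hPQ.2 u v hu'.2 hv'.2 ⟨huv, Finset.mem_inter.2 ⟨huB, (hs'.1 u).resolve_right hu'.1⟩,
        Finset.mem_inter.2 ⟨(hs.1 v).resolve_left hv'.1, hvA'⟩⟩
  obtain ⟨P, hd, hc, hX, hY⟩ := menger _ _ _ _ hmenger
  obtain ⟨hcov, huniq⟩ := transversal_of_card_le hd hX le_rfl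
  have hsub : ∀ i, P i ⊆ B ∩ A' := fun i => by
    obtain ⟨v, hv, hvX⟩ := hX i
    simp only [Finset.mem_inter] at hvX
    exact (hc i).subset_of_within hv (Finset.mem_inter.2 ⟨hvX.2, hA hvX.1⟩)
  have : ∀ s, ∃ Q : Finset V, s ∈ A ∩ B → ∃ i, s ∈ P i ∧ Q = P i := by
    intro s
    by_cases hs : s ∈ A ∩ B
    · obtain ⟨i, hi⟩ := hcov s hs
      exact ⟨P i, fun _ => ⟨i, hi, rfl⟩⟩
    · exact ⟨∅, fun h => absurd h hs⟩
  choose Q hQ using this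
  refine ⟨Q, fun s hs => ?_, fun s hs t ht hst => ?_⟩
  · obtain ⟨i, hi, hQi⟩ := hQ s hs
    rw [hQi]
    refine ⟨hi, (hc i).mono (within_le _ _), hsub i, fun v hv hvA => ?_, hY i⟩
    exact huniq i v hv s hi (Finset.mem_inter.2 ⟨hvA, (Finset.mem_inter.1 (hsub i hv)).1⟩) hs
  · obtain ⟨i, hi, hQi⟩ := hQ s hs
    obtain ⟨j, hj, hQj⟩ := hQ t ht
    rw [hQi, hQj]
    refine hd fun hij => hst ?_
    subst hij
    exact huniq i s hi t hj hs ht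

lemma exists_min_separation [Fintype V] {G : SimpleGraph V} {A B A' B' : Finset V}
    (hs : G.IsSeparation A B) (hs' : G.IsSeparation A' B') (hA : A ⊆ A') (hB : B' ⊆ B) :
    ∃ C D, G.IsSeparation C D ∧ A ⊆ C ∧ C ⊆ A' ∧ B' ⊆ D ∧ D ⊆ B ∧
      G.IsLinked C D A' B' ∧ G.IsLinked D C B A ∧
      ∀ C' D', G.IsSeparation C' D' → A ⊆ C' → C' ⊆ A' → B' ⊆ D' → D' ⊆ B →
        (C ∩ D).card ≤ (C' ∩ D').card := by
  classical
  obtain ⟨⟨C, D⟩, hCD, hmin⟩ := Finset.exists_min_image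
    ((Finset.univ : Finset (Finset V × Finset V)).filter fun p => G.IsSeparation p.1 p.2 ∧
      A ⊆ p.1 ∧ p.1 ⊆ A' ∧ B' ⊆ p.2 ∧ p.2 ⊆ B) (fun p => (p.1 ∩ p.2).card)
    ⟨(A, B), by simp [hs, hA, hB]⟩
  simp only [Finset.mem_filter, Finset.mem_univ, true_and, Prod.forall] at hCD hmin
  obtain ⟨h0, h1, h2, h3, h4⟩ := hCD
  refine ⟨C, D, h0, h1, h2, h3, h4, ?_, ?_, fun C' D' a b c d e => hmin C' D' ⟨a, b, c, d, e⟩⟩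
  · exact isLinked_of_forall_card_le h0 hs' h2 h3 fun E F hEF e1 e2 e3 e4 =>
      hmin E F ⟨hEF, h1.trans e1, e2, e3, e4.trans h4⟩
  · refine isLinked_of_forall_card_le h0.symm hs.symm h4 h1 fun E F hEF e1 e2 e3 e4 => ?_
    rw [Finset.inter_comm D, Finset.inter_comm E]
    exact hmin F E ⟨hEF.symm, e3, e4.trans h2, h3.trans e1, e2⟩

/-- The list `L` is closed under passing to smaller separations of no larger order, up to
separations whose first side is already small. -/
def IsClosedList (G : SimpleGraph V) (m : ℕ) (L : Set (Finset V × Finset V)) : Prop :=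
  ∀ A B, (A, B) ∈ L → ∀ A' B', G.IsSeparation A' B' → A' ⊆ A → B ⊆ B' →
    (A' ∩ B').card ≤ (A ∩ B).card → (A', B') ≠ (A, B) → G.IsSmallSide m L A' B'

lemma IsSmallSide.mono {G : SimpleGraph V} {m : ℕ} {L L' : Set (Finset V × Finset V)}
    (hL : L ⊆ L') {A B : Finset V} (h : G.IsSmallSide m L A B) : G.IsSmallSide m L' A B := by
  induction h with
  | leaf h hs => exact .leaf (hL h) hs
  | bag hs hA => exact .bag hs hA
  | join _ _ hs h1 h2 h3 h4 h5 h6 h7 ih₁ ih₂ => exact .join ih₁ ih₂ hs h1 h2 h3 h4 h5 h6 h7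

lemma IsSmallSide.absorb [Fintype V] {G : SimpleGraph V} {m : ℕ} {L : Set (Finset V × Finset V)}
    {A B A' B' : Finset V} (h : G.IsSmallSide m L A B) (hs : G.IsSeparation A' B')
    (hA : A ⊆ A') (hB : B' ⊆ B) (hcard : (B ∩ A').card ≤ m) : G.IsSmallSide m L A' B' :=
  .join h (.bag (A := ∅) (B := Finset.univ) ⟨by simp, by simp⟩ (by simp)) hs hA (by simp) hB
    (by simp) (by simp) (by simp) (by simpa using hcard)

lemma IsSmallSide.glue [Fintype V] {G : SimpleGraph V} {m : ℕ} {L : Set (Finset V × Finset V)}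
    {A B : Finset V} (h : G.IsSmallSide m L A B) (h' : G.IsSmallSide m L B A)
    (hcard : (A ∩ B).card ≤ m) : G.IsSmallSide m L Finset.univ ∅ :=
  .join h h' ⟨by simp, by simp⟩ (by simp) (by simp) (by simp) (by simp) subset_rfl subset_rfl
    (by simpa [Finset.inter_comm] using hcard)

lemma IsSeparation.inter_union {G : SimpleGraph V} {A B C D : Finset V}
    (h : G.IsSeparation A B) (h' : G.IsSeparation C D) : G.IsSeparation (A ∩ C) (B ∪ D) := by
  refine ⟨fun v => ?_, fun u v hu hv huv => ?_⟩
  · have := h.1 v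
    have := h'.1 v
    simp only [Finset.mem_inter, Finset.mem_union]
    tauto
  · have := h.2 u v
    have := h'.2 u v
    simp only [Finset.mem_inter, Finset.mem_union] at hu hv
    tauto

/-- A small side can be cut down along a separation `(C, D)` that is linked to the root. -/
lemma IsSmallSide.shift {G : SimpleGraph V} {m : ℕ} {L : Set (Finset V × Finset V)}
    (hL : G.IsClosedList m L) {C D A' B' : Finset V} (hCD : G.IsSeparation C D)
    (hlink : G.IsLinked C D A' B') {A B : Finset V} (h : G.IsSmallSide m L A B) (hB : B' ⊆ B) :
    G.IsSmallSide m L (A ∩ C) (B ∪ D) := by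
  obtain ⟨P, hP, hPd⟩ := hlink
  have hcross : ∀ A B, G.IsSeparation A B → B' ⊆ B → ∀ s ∈ C ∩ D, s ∉ B →
      ∃ v ∈ P s, v ∈ A ∩ B ∧ v ∉ C := by
    intro A B hAB hB s hs hsB
    obtain ⟨h1, h2, -, h4, b, hb, hbB⟩ := hP s hs
    obtain ⟨v, hv, hvA, hvB⟩ := h2.exists_mem_inter hAB h1 ((hAB.1 s).resolve_right hsB) hb
      (hB (Finset.mem_inter.1 hbB).2)
    exact ⟨v, hv, Finset.mem_inter.2 ⟨hvA, hvB⟩, fun hvC => hsB (h4 v hv hvC ▸ hvB)⟩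
  have hcount : ∀ Z Z' : Finset V, (∀ s ∈ Z', (s ∈ Z ∧ s ∈ C) ∨
      (s ∈ C ∩ D ∧ ∃ v ∈ P s, v ∈ Z ∧ v ∉ C)) → Z'.card ≤ Z.card := by
    intro Z Z' hZ
    have : ∀ s, ∃ v, s ∈ Z' → v ∈ Z ∧ ((v = s ∧ s ∈ C) ∨ (s ∈ C ∩ D ∧ v ∈ P s ∧ v ∉ C)) := by
      intro s
      by_cases hs : s ∈ Z'
      · rcases hZ s hs with h | ⟨h, v, h1, h2, h3⟩
        · exact ⟨s, fun _ => ⟨h.1, Or.inl ⟨rfl, h.2⟩⟩⟩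
        · exact ⟨v, fun _ => ⟨h2, Or.inr ⟨h, h1, h3⟩⟩⟩
      · exact ⟨s, fun h => absurd h hs⟩
    choose f hf using this
    refine Finset.card_le_card_of_injOn f (fun s hs => (hf s hs).1) fun s hs t ht hst => ?_
    rcases (hf s hs).2 with ⟨h1, h2⟩ | ⟨h1, h2, h3⟩ <;>
      rcases (hf t ht).2 with ⟨h4, h5⟩ | ⟨h4, h5, h6⟩
    · rw [← h1, ← h4, hst]
    · exact absurd (by rw [← hst, h1]; exact h2) h6
    · exact absurd (by rw [hst, h4]; exact h5) h3
    · by_contra hne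
      exact Finset.disjoint_left.1 (hPd s h1 t h4 hne) h2 (hst ▸ h5)
  induction h with
  | @leaf A B h hs =>
    by_cases heq : (A ∩ C, B ∪ D) = (A, B)
    · rw [Prod.mk.injEq] at heq
      rw [heq.1, heq.2]
      exact .leaf h hs
    · refine hL A B h _ _ (hs.inter_union hCD) Finset.inter_subset_left
        Finset.subset_union_left (hcount _ _ fun s hs' => ?_) heq
      simp only [Finset.mem_inter, Finset.mem_union] at hs'
      by_cases hsB : s ∈ B
      · exact Or.inl ⟨Finset.mem_inter.2 ⟨hs'.1.1, hsB⟩, hs'.1.2⟩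
      · have hsCD : s ∈ C ∩ D := Finset.mem_inter.2 ⟨hs'.1.2, hs'.2.resolve_left hsB⟩
        exact Or.inr ⟨hsCD, hcross A B hs hB s hsCD hsB⟩
  | bag hs hA =>
    exact .bag (hs.inter_union hCD) ((Finset.card_le_card Finset.inter_subset_left).trans hA)
  | @join A B A₁ B₁ A₂ B₂ h₁ h₂ hs hA₁ hA₂ hB₁ hB₂ h12 h21 hcard ih₁ ih₂ =>
    refine .join (ih₁ (hB.trans hB₁)) (ih₂ (hB.trans hB₂)) (hs.inter_union hCD)
      (Finset.inter_subset_inter_right hA₁) (Finset.inter_subset_inter_right hA₂)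
      (Finset.union_subset_union_left hB₁) (Finset.union_subset_union_left hB₂)
      (Finset.inter_subset_left.trans (h12.trans Finset.subset_union_left))
      (Finset.inter_subset_left.trans (h21.trans Finset.subset_union_left))
      ((hcount _ _ fun s hs' => ?_).trans hcard)
    simp only [Finset.mem_inter, Finset.mem_union] at hs'
    by_cases hsB₁ : s ∈ B₁
    · by_cases hsB₂ : s ∈ B₂
      · exact Or.inl ⟨by simp [hsB₁, hsB₂, hs'.2.1], hs'.2.2⟩
      · have hsCD : s ∈ C ∩ D := by
          simp only [Finset.mem_inter]
          tauto
        obtain ⟨v, hv, hvZ, hvC⟩ := hcross A₂ B₂ h₂.isSeparation (hB.trans hB₂) s hsCD hsB₂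
        rw [Finset.mem_inter] at hvZ
        exact Or.inr ⟨hsCD, v, hv, by simp [hvZ.2, h21 hvZ.1, hA₂ hvZ.1], hvC⟩
    · have hsCD : s ∈ C ∩ D := by
        simp only [Finset.mem_inter]
        tauto
      obtain ⟨v, hv, hvZ, hvC⟩ := hcross A₁ B₁ h₁.isSeparation (hB.trans hB₁) s hsCD hsB₁
      rw [Finset.mem_inter] at hvZ
      exact Or.inr ⟨hsCD, v, hv, by simp [hvZ.2, h12 hvZ.1, hA₁ hvZ.1], hvC⟩

lemma IsSmallSide.of_isLinked {G : SimpleGraph V} {m : ℕ} {L : Set (Finset V × Finset V)}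
    (hL : G.IsClosedList m L) {C D A B : Finset V} (h : G.IsSmallSide m L A B)
    (hCD : G.IsSeparation C D) (hlink : G.IsLinked C D A B) (hC : C ⊆ A) (hD : B ⊆ D) :
    G.IsSmallSide m L C D := by
  have := h.shift hL hCD hlink subset_rfl
  rwa [Finset.inter_eq_right.2 hC, Finset.union_eq_right.2 hD] at this

lemma IsSmallSide.of_insert {G : SimpleGraph V} {m : ℕ} {L : Set (Finset V × Finset V)}
    {X X' A B : Finset V} (h : G.IsSmallSide m (insert (X, X') L) A B) :
    G.IsSmallSide m L A B ∨ ∀ v, v ∉ X' → v ∉ B := by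
  induction h with
  | leaf h hs =>
    rcases h with h | h
    · rw [Prod.mk.injEq] at h
      right
      simp [h.2]
    · exact Or.inl (.leaf h hs)
  | bag hs hA => exact Or.inl (.bag hs hA)
  | join _ _ hs h1 h2 h3 h4 h5 h6 h7 ih₁ ih₂ =>
    rcases ih₁ with ih₁ | ih₁
    · rcases ih₂ with ih₂ | ih₂
      · exact Or.inl (.join ih₁ ih₂ hs h1 h2 h3 h4 h5 h6 h7)
      · exact Or.inr fun v hv hvB => ih₂ v hv (h4 hvB)
    · exact Or.inr fun v hv hvB => ih₁ v hv (h3 hvB)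

/-- Removing the additional leaf `(X, X')` from a decomposition of the whole graph leaves
a decomposition of the complementary side. -/
lemma IsSmallSide.swap_of_insert [Fintype V] {G : SimpleGraph V} {m : ℕ}
    {L : Set (Finset V × Finset V)} (htop : ¬ G.IsSmallSide m L Finset.univ ∅)
    {X X' : Finset V} (hX : ∃ v, v ∉ X') {A B : Finset V}
    (h : G.IsSmallSide m (insert (X, X') L) A B) (hcard : (A ∩ B).card ≤ m)
    (hBA : G.IsSmallSide m L B A) : G.IsSmallSide m L X' X := by
  induction h with
  | leaf h hs =>
    rcases h with h | h
    · rw [Prod.mk.injEq] at h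
      rw [← h.1, ← h.2]
      exact hBA
    · exact absurd ((leaf h hs).glue hBA hcard) htop
  | bag hs hA => exact absurd ((bag hs hA).glue hBA hcard) htop
  | @join A B A₁ B₁ A₂ B₂ h₁ h₂ hs hA₁ hA₂ hB₁ hB₂ h12 h21 hZ ih₁ ih₂ =>
    have s₁ := h₁.isSeparation
    have s₂ := h₂.isSeparation
    by_cases k₁ : G.IsSmallSide m L A₁ B₁
    · refine ih₂ ((Finset.card_le_card fun v hv => ?_).trans hZ)
        (.join k₁ hBA s₂.symm h12 hB₂ h21 hA₂ hA₁ hB₁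
          ((Finset.card_le_card fun v hv => ?_).trans hZ))
      · simp only [Finset.mem_inter] at hv ⊢
        exact ⟨⟨h21 hv.1, hv.2⟩, hA₂ hv.1⟩
      · simp only [Finset.mem_inter] at hv ⊢
        tauto
    · by_cases k₂ : G.IsSmallSide m L A₂ B₂
      · refine ih₁ ((Finset.card_le_card fun v hv => ?_).trans hZ)
          (.join k₂ hBA s₁.symm h21 hB₁ h12 hA₁ hA₂ hB₂
            ((Finset.card_le_card fun v hv => ?_).trans hZ))
        · simp only [Finset.mem_inter] at hv ⊢
          exact ⟨⟨hv.2, h12 hv.1⟩, hA₁ hv.1⟩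
        · simp only [Finset.mem_inter] at hv ⊢
          tauto
      · obtain ⟨v, hv⟩ := hX
        have e₁ := (h₁.of_insert.resolve_left k₁) v hv
        have e₂ := (h₂.of_insert.resolve_left k₂) v hv
        exact absurd (h12 ((s₁.1 v).resolve_right e₁)) e₂

/-- If `G` has no tree decomposition with bags of size at most `m`, then there is a list `L` such
that the whole graph is not small, but every separation of order at most `w ≤ m` has a small
side. -/
theorem exists_closedList [Fintype V] {G : SimpleGraph V} {m w : ℕ} (hw : w ≤ m)
    (h : ¬ G.IsSmallSide m ∅ Finset.univ ∅) :
    ∃ L, G.IsClosedList m L ∧ ¬ G.IsSmallSide m L Finset.univ ∅ ∧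
      ∀ C D, G.IsSeparation C D → (C ∩ D).card ≤ w →
        G.IsSmallSide m L C D ∨ G.IsSmallSide m L D C := by
  classical
  obtain ⟨L, ⟨hL, htop⟩, hmax⟩ := (Set.toFinite {L | G.IsClosedList m L ∧
    ¬ G.IsSmallSide m L Finset.univ ∅}).exists_maximal ⟨∅, fun _ _ h => h.elim, h⟩
  refine ⟨L, hL, htop, ?_⟩
  have key : ∀ C D, G.IsSeparation C D → (C ∩ D).card ≤ w → ¬ G.IsSmallSide m L C D →
      ∃ X X', G.IsSeparation X X' ∧ X ⊆ C ∧ D ⊆ X' ∧ G.IsSmallSide m L X' X := by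
    intro C D hCD hcard hsmall
    obtain ⟨⟨X, X'⟩, hX, hmin⟩ := Finset.exists_min_image
      ((Finset.univ : Finset (Finset V × Finset V)).filter fun p => G.IsSeparation p.1 p.2 ∧
        p.1 ⊆ C ∧ D ⊆ p.2 ∧ (p.1 ∩ p.2).card ≤ w ∧ ¬ G.IsSmallSide m L p.1 p.2)
      (fun p => p.1.card + (p.2ᶜ).card) ⟨(C, D), by simp [hCD, hcard, hsmall]⟩
    simp only [Finset.mem_filter, Finset.mem_univ, true_and, Prod.forall] at hX hmin
    obtain ⟨hs, hXC, hDX, hXw, hXs⟩ := hX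
    refine ⟨X, X', hs, hXC, hDX, ?_⟩
    have hclosed : G.IsClosedList m (insert (X, X') L) := by
      intro A B hAB A' B' hs' hA hB hcard' hne
      rcases hAB with hAB | hAB
      · rw [Prod.mk.injEq] at hAB
        obtain ⟨rfl, rfl⟩ := hAB
        by_contra hcon
        have hle : A.card + Bᶜ.card ≤ A'.card + B'ᶜ.card := hmin A' B'
          ⟨hs', hA.trans hXC, hDX.trans hB, hcard'.trans hXw,
            fun h => hcon (h.mono (Set.subset_insert _ _))⟩
        have h1 := Finset.card_le_card hA
        have hB' := Finset.compl_subset_compl.2 hB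
        have h2 := Finset.card_le_card hB'
        have hA_eq : A' = A := Finset.eq_of_subset_of_card_le hA (by omega)
        have hB_eq : B' = B := compl_injective (Finset.eq_of_subset_of_card_le hB' (by omega))
        exact hne (by rw [hA_eq, hB_eq])
      · exact (hL A B hAB A' B' hs' hA hB hcard' hne).mono (Set.subset_insert _ _)
    have hins : G.IsSmallSide m (insert (X, X') L) Finset.univ ∅ := by
      by_contra hcon
      exact hXs (.leaf (hmax ⟨hclosed, hcon⟩ (Set.subset_insert _ _) (Set.mem_insert _ _)) hs)
    refine hins.swap_of_insert htop ?_ (by simp) (.bag ⟨by simp, by simp⟩ (by simp))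
    by_contra! hall
    refine hXs (.bag hs ?_)
    rw [(Finset.inter_eq_left (s := X) (t := X')).2 fun v _ => hall v] at hXw
    exact hXw.trans hw
  intro C D hCD hcard
  by_contra! hcon
  obtain ⟨X, X', hX, hXC, hDX, hXs⟩ := key C D hCD hcard hcon.1
  obtain ⟨Y, Y', hY, hYD, hCY, hYs⟩ := key D C hCD.symm (by rwa [Finset.inter_comm]) hcon.2
  obtain ⟨E, F, hEF, h1, h2, h3, h4, hl, hr, hmin⟩ :=
    exists_min_separation hX hY.symm (hXC.trans hCY) (hYD.trans hDX)
  exact htop ((hYs.of_isLinked hL hEF hl h2 h3).glue (hXs.of_isLinked hL hEF.symm hr h4 h1)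
    (((hmin C D hCD hXC hCY hYD hDX).trans hcard).trans hw))

end Orientation

section Growth

variable {V : Type*} [DecidableEq V]

/-- `(A, B)` has a small side, has order `k`, and cannot be enlarged without increasing
its order. -/
def IsMaximalSmall (G : SimpleGraph V) (m : ℕ) (L : Set (Finset V × Finset V)) (k : ℕ)
    (A B : Finset V) : Prop :=
  G.IsSmallSide m L A B ∧ (A ∩ B).card = k ∧ ∀ C D, G.IsSmallSide m L C D → A ⊆ C →
    D ⊆ B → (C ∩ D).card ≤ k → C = A ∧ D = B

/-- The sets `M 0, …, M (k - 1)` are disjoint connected subsets of `A`, each `M i` contains the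
vertex `x i` of the separator `A ∩ B`, and each `M i` with `0 < i` is joined by an edge
to `M (p i)`. -/
structure IsGrown (G : SimpleGraph V) (p : ℕ → ℕ) (k : ℕ) (A B : Finset V)
    (M : ℕ → Finset V) (x : ℕ → V) : Prop where
  connSet : ∀ i < k, G.IsConnSet (M i)
  subset : ∀ i < k, M i ⊆ A
  root_mem : ∀ i < k, x i ∈ M i
  root_mem_inter : ∀ i < k, x i ∈ A ∩ B
  disjoint : ∀ i < k, ∀ j < k, i ≠ j → Disjoint (M i) (M j)
  adj : ∀ i < k, 0 < i → ∃ a ∈ M i, ∃ b ∈ M (p i), G.Adj a b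

lemma IsSmallSide.exists_maximal [Fintype V] {G : SimpleGraph V} {m k : ℕ}
    {L : Set (Finset V × Finset V)} {A B : Finset V} (h : G.IsSmallSide m L A B)
    (hk : (A ∩ B).card ≤ k) :
    ∃ A' B', G.IsSmallSide m L A' B' ∧ A ⊆ A' ∧ B' ⊆ B ∧ (A' ∩ B').card ≤ k ∧
      ∀ A'' B'', G.IsSmallSide m L A'' B'' → A' ⊆ A'' → B'' ⊆ B' → (A'' ∩ B'').card ≤ k →
        A'' = A' ∧ B'' = B' := by
  classical
  obtain ⟨⟨A', B'⟩, hX, hmax⟩ := Finset.exists_max_image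
    ((Finset.univ : Finset (Finset V × Finset V)).filter fun p => G.IsSmallSide m L p.1 p.2 ∧
      A ⊆ p.1 ∧ p.2 ⊆ B ∧ (p.1 ∩ p.2).card ≤ k)
    (fun p => p.1.card + (p.2ᶜ).card) ⟨(A, B), by simp [h, hk]⟩
  simp only [Finset.mem_filter, Finset.mem_univ, true_and, Prod.forall] at hX hmax
  obtain ⟨hs, hA, hB, hcard⟩ := hX
  refine ⟨A', B', hs, hA, hB, hcard, fun A'' B'' hs' hA' hB' hcard' => ?_⟩
  have hle := hmax A'' B'' ⟨hs', hA.trans hA', hB'.trans hB, hcard'⟩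
  have h1 := Finset.card_le_card hA'
  have hB'' := Finset.compl_subset_compl.2 hB'
  have h2 := Finset.card_le_card hB''
  exact ⟨(Finset.eq_of_subset_of_card_le hA' (by omega)).symm,
    compl_injective (Finset.eq_of_subset_of_card_le hB'' (by omega)).symm⟩

lemma IsMaximalSmall.exists_adj [Fintype V] {G : SimpleGraph V} {m k : ℕ}
    {L : Set (Finset V × Finset V)} {A B : Finset V} (h : G.IsMaximalSmall m L k A B)
    (hkm : k ≤ m) {x : V} (hx : x ∈ A ∩ B) : ∃ y ∈ B, y ∉ A ∧ G.Adj x y := by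
  by_contra! hcon
  obtain ⟨hs, hcard, hmax⟩ := h
  rw [Finset.mem_inter] at hx
  have hsep : G.IsSeparation A (B.erase x) := by
    refine ⟨fun v => ?_, fun u v hu hv huv => ?_⟩
    · by_cases hvx : v = x
      · exact Or.inl (hvx ▸ hx.1)
      · simpa [hvx] using hs.isSeparation.1 v
    · by_cases hux : u = x
      · exact hcon v ((hs.isSeparation.1 v).resolve_left hv) hv (hux ▸ huv)
      · exact hs.isSeparation.2 u v (by simpa [hux] using hu) hv huv
  have := (hmax _ _ (hs.absorb hsep subset_rfl (Finset.erase_subset _ _)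
    (by rw [Finset.inter_comm]; omega)) subset_rfl (Finset.erase_subset _ _)
    (hcard ▸ Finset.card_le_card (Finset.inter_subset_inter_left (Finset.erase_subset _ _)))).2
  exact Finset.notMem_erase x B (this.symm ▸ hx.2)

lemma IsGrown.insert {G : SimpleGraph V} {p : ℕ → ℕ} (hp : ∀ i, 0 < i → p i < i) {k : ℕ}
    {A B : Finset V} {M : ℕ → Finset V} {x : ℕ → V} (h : G.IsGrown p k A B M x) {y : V}
    (hyA : y ∉ A) (hyB : y ∈ B) (hadj : 0 < k → ∃ z ∈ M (p k), G.Adj y z) :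
    G.IsGrown p (k + 1) (insert y A) B (Function.update M k {y}) (Function.update x k y) := by
  have hne : ∀ i < k + 1, i ≠ k → i < k := fun i hi h => by omega
  have hdisj : ∀ i < k, Disjoint (M i) {y} := fun i hi =>
    Finset.disjoint_singleton_right.2 fun hy => hyA (h.subset i hi hy)
  refine ⟨fun i hi => ?_, fun i hi => ?_, fun i hi => ?_, fun i hi => ?_,
    fun i hi j hj hij => ?_, fun i hi h0 => ?_⟩
  · by_cases hik : i = k
    · simpa [hik] using isConnSet_singleton G y
    · simpa [hik] using h.connSet i (hne i hi hik)
  · by_cases hik : i = k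
    · simp [hik]
    · simpa [hik] using (h.subset i (hne i hi hik)).trans (Finset.subset_insert _ _)
  · by_cases hik : i = k
    · simp [hik]
    · simpa [hik] using h.root_mem i (hne i hi hik)
  · by_cases hik : i = k
    · simp [hik, hyB]
    · have := h.root_mem_inter i (hne i hi hik)
      rw [Finset.mem_inter] at this
      simp [hik, this]
  · by_cases hik : i = k
    · have hjk : j ≠ k := fun h => hij (hik.trans h.symm)
      simpa [hik, hjk] using (hdisj j (hne j hj hjk)).symm
    · by_cases hjk : j = k
      · simpa [hik, hjk] using hdisj i (hne i hi hik)
      · simpa [hik, hjk] using h.disjoint i (hne i hi hik) j (hne j hj hjk) hij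
  · have hpk : p i ≠ k := by have := hp i h0; omega
    by_cases hik : i = k
    · obtain ⟨z, hz, hyz⟩ := hadj (hik ▸ h0)
      exact ⟨y, by simp [hik], z, by rw [Function.update_of_ne hpk, hik]; exact hz, hyz⟩
    · simpa [hik, hpk] using h.adj i (hne i hi hik) h0

lemma IsGrown.extend {G : SimpleGraph V} {p : ℕ → ℕ} {k : ℕ} {A B A' B' : Finset V}
    {M : ℕ → Finset V} {x : ℕ → V} (h : G.IsGrown p k A B M x)
    (hlink : G.IsLinked A B A' B') (hA : A ⊆ A') : ∃ M' x', G.IsGrown p k A' B' M' x' := by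
  obtain ⟨P, hP, hPd⟩ := hlink
  have : ∀ i, ∃ y, i < k → y ∈ P (x i) ∧ y ∈ A' ∩ B' := fun i => by
    by_cases hi : i < k
    · obtain ⟨y, hy⟩ := (hP _ (h.root_mem_inter i hi)).2.2.2.2
      exact ⟨y, fun _ => hy⟩
    · exact ⟨x i, fun h => absurd h hi⟩
  choose y hy using this
  have hroot : ∀ i < k, ∀ j < k, i ≠ j → x i ∉ M j := fun i hi j hj hij hx =>
    Finset.disjoint_left.1 (h.disjoint i hi j hj hij) (h.root_mem i hi) hx
  have hcross : ∀ i < k, ∀ j < k, i ≠ j → ∀ v ∈ M i, v ∉ P (x j) := fun i hi j hj hij v hv hvP =>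
    hroot j hj i hi hij.symm
      ((hP _ (h.root_mem_inter j hj)).2.2.2.1 v hvP (h.subset i hi hv) ▸ hv)
  refine ⟨fun i => M i ∪ P (x i), y, fun i hi => ?_, fun i hi => ?_,
    fun i hi => Finset.mem_union_right _ (hy i hi).1, fun i hi => (hy i hi).2,
    fun i hi j hj hij => ?_, fun i hi h0 => ?_⟩
  · have := hP _ (h.root_mem_inter i hi)
    exact (h.connSet i hi).union this.2.1 (h.root_mem i hi) this.1 (Or.inl rfl)
  · exact Finset.union_subset ((h.subset i hi).trans hA)
      ((hP _ (h.root_mem_inter i hi)).2.2.1.trans Finset.inter_subset_right)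
  · refine Finset.disjoint_left.2 fun v hv hv' => ?_
    rcases Finset.mem_union.1 hv with hv | hv <;> rcases Finset.mem_union.1 hv' with hv' | hv'
    · exact Finset.disjoint_left.1 (h.disjoint i hi j hj hij) hv hv'
    · exact hcross i hi j hj hij v hv hv'
    · exact hcross j hj i hi hij.symm v hv' hv
    · exact Finset.disjoint_left.1 (hPd _ (h.root_mem_inter i hi) _ (h.root_mem_inter j hj)
        fun heq => hroot i hi j hj hij (heq ▸ h.root_mem j hj)) hv hv'
  · obtain ⟨a, ha, b, hb, hab⟩ := h.adj i hi h0
    exact ⟨a, Finset.mem_union_left _ ha, b, Finset.mem_union_left _ hb, hab⟩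

/-- A forest with parent function `p` on `k ≤ w` vertices can be grown rooted in the separator of a
maximal small separation of order `k`. -/
lemma exists_isGrown [Fintype V] {G : SimpleGraph V} {m w : ℕ} {L : Set (Finset V × Finset V)}
    (hw : w ≤ m) (hL : G.IsClosedList m L) (htop : ¬ G.IsSmallSide m L Finset.univ ∅)
    {p : ℕ → ℕ} (hp : ∀ i, 0 < i → p i < i) {k : ℕ} (hk : k ≤ w) :
    ∃ A B M x, G.IsMaximalSmall m L k A B ∧ G.IsGrown p k A B M x := by
  induction k with
  | zero =>
    have hbag : G.IsSmallSide m L ∅ Finset.univ := .bag ⟨by simp, by simp⟩ (by simp)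
    have hV : Nonempty V := by
      by_contra hV
      rw [not_nonempty_iff] at hV
      exact htop (.bag ⟨by simp, by simp⟩ (by simp))
    obtain ⟨A, B, hs, -, -, hcard, hmax⟩ := hbag.exists_maximal (k := 0) (by simp)
    exact ⟨A, B, fun _ => ∅, fun _ => Classical.arbitrary V, ⟨hs, by omega, hmax⟩, by
      constructor <;> simp⟩
  | succ k ih =>
    obtain ⟨A, B, M, x, hM, hG⟩ := ih (by omega)
    obtain ⟨hs, hcard, hmax⟩ := id hM
    obtain ⟨y, hyB, hyA, hadj⟩ : ∃ y ∈ B, y ∉ A ∧ (0 < k → ∃ z ∈ M (p k), G.Adj y z) := by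
      rcases Nat.eq_zero_or_pos k with rfl | h0
      · by_contra! hcon
        have hBA : B ⊆ A := fun v hv => by
          by_contra hvA
          exact absurd (hcon v hv hvA).1 (lt_irrefl 0)
        have hB : B = ∅ := by
          rwa [Finset.inter_eq_right.2 hBA, Finset.card_eq_zero] at hcard
        subst hB
        have hA : A = Finset.univ :=
          Finset.eq_univ_iff_forall.2 fun v => (hs.isSeparation.1 v).resolve_right (by simp)
        exact htop (hA ▸ hs)
      · have hpk := hp k h0
        obtain ⟨y, hyB, hyA, hxy⟩ := hM.exists_adj (by omega) (hG.root_mem_inter _ hpk)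
        exact ⟨y, hyB, hyA, fun _ => ⟨_, hG.root_mem _ hpk, hxy.symm⟩⟩
    have hinter : insert y A ∩ B = insert y (A ∩ B) := Finset.insert_inter_of_mem hyB
    have hcard' : (insert y A ∩ B).card = k + 1 := by
      rw [hinter, Finset.card_insert_of_notMem (by simp [hyA]), hcard]
    have hsep : G.IsSeparation (insert y A) B := by
      refine ⟨fun v => ?_, fun u v hu hv => hs.isSeparation.2 u v hu fun h => hv (by simp [h])⟩
      rcases hs.isSeparation.1 v with h | h
      · exact Or.inl (by simp [h])
      · exact Or.inr h
    have hs' := hs.absorb hsep (Finset.subset_insert _ _) subset_rfl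
      (by rw [Finset.inter_comm]; omega)
    obtain ⟨A', B', hs'', hA', hB', hle, hmax'⟩ := hs'.exists_maximal hcard'.le
    have hyA' : ∀ C D, G.IsSmallSide m L C D → insert y A ⊆ C → D ⊆ B → k + 1 ≤ (C ∩ D).card := by
      intro C D hCD hC hD
      by_contra! hlt
      have := (hmax C D hCD ((Finset.subset_insert _ _).trans hC) hD (by omega)).1
      exact hyA (this ▸ hC (Finset.mem_insert_self _ _))
    have hlink : G.IsLinked (insert y A) B A' B' := by
      obtain ⟨C, D, hCD, h1, h2, h3, h4, hl, -, hmin⟩ :=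
        exists_min_separation hsep hs''.isSeparation hA' hB'
      refine isLinked_of_forall_card_le hsep hs''.isSeparation hA' hB'
        fun E F hEF e1 e2 e3 e4 => ?_
      rw [hcard']
      exact (hyA' C D (hs''.of_isLinked hL hCD hl h2 h3) h1 h4).trans (hmin E F hEF e1 e2 e3 e4)
    obtain ⟨M', x', hG'⟩ := (hG.insert hp hyA hyB hadj).extend hlink hA'
    exact ⟨A', B', M', x', ⟨hs'', le_antisymm hle (hyA' A' B' hs'' hA' hB'), hmax'⟩, hG'⟩

lemma IsSeparation.union_of_within {G : SimpleGraph V} {A B C D R : Finset V}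
    (h : G.IsSeparation A B) (h' : (G.within (B \ R)).IsSeparation C D) :
    G.IsSeparation (A ∪ (C ∩ B ∪ R)) (D ∩ B ∪ R) := by
  refine ⟨fun v => ?_, fun u v hu hv huv => ?_⟩
  · have := h.1 v
    have := h'.1 v
    simp only [Finset.mem_inter, Finset.mem_union]
    tauto
  · simp only [Finset.mem_inter, Finset.mem_union, not_or, not_and] at hu hv
    have hvB : v ∈ B := (h.1 v).resolve_left hv.1
    have huB : u ∈ B := by
      by_contra huB
      exact h.2 u v huB hv.1 huv
    exact h'.2 u v (fun h => hu.1 h huB) (fun h => hv.2.1 h hvB)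
      ⟨huv, by simp [huB, hu.2], by simp [hvB, hv.2.2]⟩

/-- A separation of order less than `n` in the large side, avoiding `R` and with `n` vertices of the
separator on its first side, has a small second side. -/
lemma IsMaximalSmall.isSmallSide_of_within {G : SimpleGraph V} {m w n : ℕ}
    {L : Set (Finset V × Finset V)}
    (hor : ∀ C D, G.IsSeparation C D → (C ∩ D).card ≤ w →
      G.IsSmallSide m L C D ∨ G.IsSmallSide m L D C)
    {A B : Finset V} (h : G.IsMaximalSmall m L w A B) {C D X R : Finset V}
    (hCD : (G.within (B \ R)).IsSeparation C D) (hlt : (C ∩ D).card < n) (hXC : X ⊆ C)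
    (hXn : X.card = n) (hX : X ⊆ A ∩ B) (hRX : R ⊆ (A ∩ B) \ X) :
    G.IsSmallSide m L (D ∩ B ∪ R) (A ∪ (C ∩ B ∪ R)) := by
  obtain ⟨hs, hcard, hmax⟩ := h
  have hsep := hs.isSeparation.union_of_within hCD
  have hsub : (A ∪ (C ∩ B ∪ R)) ∩ (D ∩ B ∪ R) ⊆ ((A ∩ B) \ X) ∪ (C ∩ D) := by
    intro v hv
    by_cases hvR : v ∈ R
    · exact Finset.mem_union_left _ (hRX hvR)
    have := @hXC v
    simp only [Finset.mem_inter, Finset.mem_union, Finset.mem_sdiff, hvR, or_false] at hv ⊢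
    tauto
  have hlt' : ((A ∪ (C ∩ B ∪ R)) ∩ (D ∩ B ∪ R)).card < w := by
    have h1 := (Finset.card_le_card hsub).trans (Finset.card_union_le _ _)
    rw [Finset.card_sdiff_of_subset hX] at h1
    have h2 := Finset.card_le_card hX
    omega
  refine (hor _ _ hsep hlt'.le).resolve_left fun hsmall => ?_
  have hRB : R ⊆ B := hRX.trans (Finset.sdiff_subset.trans Finset.inter_subset_right)
  have := hmax _ _ hsmall Finset.subset_union_left
    (Finset.union_subset Finset.inter_subset_right hRB) hlt'.le
  rw [this.1, this.2, hcard] at hlt'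
  exact absurd hlt' (lt_irrefl w)

/-- Two sets of `n` separator vertices of a maximal small separation of order `w` are
linked in the large side, avoiding all other vertices of the separator. -/
lemma IsMaximalSmall.exists_linkage [Fintype V] {G : SimpleGraph V} {m w n : ℕ}
    {L : Set (Finset V × Finset V)} (htop : ¬ G.IsSmallSide m L Finset.univ ∅)
    (hor : ∀ C D, G.IsSeparation C D → (C ∩ D).card ≤ w →
      G.IsSmallSide m L C D ∨ G.IsSmallSide m L D C)
    (hw : w + n ≤ m + 1) {A B : Finset V} (h : G.IsMaximalSmall m L w A B)
    {X Y : Finset V} (hX : X ⊆ A ∩ B) (hY : Y ⊆ A ∩ B) (hXn : X.card = n)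
    (hYn : Y.card = n) :
    ∃ Q : Fin n → Finset V, (Pairwise fun i j => Disjoint (Q i) (Q j)) ∧
      (∀ i, G.IsConnSet (Q i)) ∧ (∀ i, Q i ⊆ B \ ((A ∩ B) \ (X ∪ Y))) ∧
      (∀ i, ∃ v ∈ Q i, v ∈ X) ∧ ∀ i, ∃ v ∈ Q i, v ∈ Y := by
  obtain ⟨hs, hcard, -⟩ := id h
  set R := (A ∩ B) \ (X ∪ Y) with hR
  have hXR : X ⊆ B \ R := fun v hv => by
    have := (Finset.mem_inter.1 (hX hv)).2
    simp [hR, hv, this]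
  have hmenger : ∀ C D, (G.within (B \ R)).IsSeparation C D → X ⊆ C → Y ⊆ D →
      n ≤ (C ∩ D).card := by
    intro C D hCD hXC hYD
    by_contra! hlt
    have h1 := h.isSmallSide_of_within hor hCD hlt hXC hXn hX
      (Finset.sdiff_subset_sdiff subset_rfl Finset.subset_union_left)
    have h2 := h.isSmallSide_of_within hor hCD.symm (by rwa [Finset.inter_comm]) hYD hYn hY
      (Finset.sdiff_subset_sdiff subset_rfl Finset.subset_union_right)
    have hRS : R ⊆ A ∩ B := Finset.sdiff_subset
    have hsub : (A ∪ (C ∩ B ∪ R)) ∩ (A ∪ (D ∩ B ∪ R)) ∩ B ⊆ (A ∩ B) ∪ (C ∩ D) := by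
      intro v hv
      have := @hRS v
      simp only [Finset.mem_inter, Finset.mem_union] at hv this ⊢
      tauto
    have hRB : R ⊆ B := hRS.trans Finset.inter_subset_right
    have hBA : G.IsSmallSide m L B A :=
      .join h1 h2 hs.isSeparation.symm (Finset.union_subset Finset.inter_subset_right hRB)
        (Finset.union_subset Finset.inter_subset_right hRB) Finset.subset_union_left
        Finset.subset_union_left Finset.subset_union_right Finset.subset_union_right (by
          have := (Finset.card_le_card hsub).trans (Finset.card_union_le _ _)
          omega)
    exact htop (hs.glue hBA (by omega))
  obtain ⟨Q, hd, hc, hQX, hQY⟩ := menger _ _ _ _ hmenger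
  refine ⟨Q, hd, fun i => (hc i).mono (within_le _ _), fun i => ?_, hQX, hQY⟩
  obtain ⟨v, hv, hvX⟩ := hQX i
  exact (hc i).subset_of_within hv (hXR hvX)

/-- The linkage between two disjoint sets of `n` roots, as connected sets attached to
the first set of roots and adjacent to the second one. -/
lemma IsMaximalSmall.exists_attachments [Fintype V] {G : SimpleGraph V} {m w n : ℕ}
    {L : Set (Finset V × Finset V)} (htop : ¬ G.IsSmallSide m L Finset.univ ∅)
    (hor : ∀ C D, G.IsSeparation C D → (C ∩ D).card ≤ w →
      G.IsSmallSide m L C D ∨ G.IsSmallSide m L D C)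
    (hw : w + n ≤ m + 1) {A B : Finset V} (h : G.IsMaximalSmall m L w A B)
    {a b : Fin n → V} (ha : Function.Injective a) (hb : Function.Injective b)
    (hab : ∀ i j, a i ≠ b j) (haS : ∀ i, a i ∈ A ∩ B) (hbS : ∀ i, b i ∈ A ∩ B) :
    ∃ (K : Fin n → Finset V) (ψ : Fin n ≃ Fin n),
      (Pairwise fun i j => Disjoint (K i) (K j)) ∧ ∀ j, G.IsConnSet (K j) ∧ a j ∈ K j ∧
        (∀ v ∈ K j, v ∈ A → v = a j) ∧ ∃ z ∈ K j, G.Adj z (b (ψ j)) := by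
  have hXn : (Finset.univ.image a).card = n := by simp [Finset.card_image_of_injective _ ha]
  have hYn : (Finset.univ.image b).card = n := by simp [Finset.card_image_of_injective _ hb]
  obtain ⟨Q, hd, hc, hQ, hQX, hQY⟩ := h.exists_linkage htop hor hw
    (X := Finset.univ.image a) (Y := Finset.univ.image b)
    (Finset.image_subset_iff.2 fun i _ => haS i) (Finset.image_subset_iff.2 fun i _ => hbS i)
    hXn hYn
  obtain ⟨hXcov, hXu⟩ := transversal_of_card_le hd hQX hXn.le
  obtain ⟨-, hYu⟩ := transversal_of_card_le hd hQY hYn.le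
  have haX : ∀ i, a i ∈ Finset.univ.image a := fun i => by simp
  have hbY : ∀ i, b i ∈ Finset.univ.image b := fun i => by simp
  choose σ hσ using fun j => hXcov (a j) (haX j)
  have hψ : ∀ j, ∃ i, b i ∈ Q (σ j) := fun j => by
    obtain ⟨v, hv, hvY⟩ := hQY (σ j)
    obtain ⟨i, -, rfl⟩ := Finset.mem_image.1 hvY
    exact ⟨i, hv⟩
  choose ψ hψ using hψ
  have hσinj : Function.Injective σ := fun i j hij =>
    ha (hXu (σ i) _ (hσ i) _ (hij ▸ hσ j) (haX i) (haX j))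
  have hψinj : Function.Injective ψ := fun i j hij => by
    by_contra hne
    exact Finset.disjoint_left.1 (hd (hσinj.ne hne)) (hψ i) (hij ▸ hψ j)
  choose K hKQ hKb hKa hKc hKadj using fun j =>
    (hc (σ j)).exists_subset_adj (hσ j) (hψ j) (hab j (ψ j))
  refine ⟨K, .ofBijective ψ (Finite.injective_iff_bijective.1 hψinj), fun i j hij =>
    (hd (hσinj.ne hij)).mono (hKQ i) (hKQ j), fun j => ⟨hKc j, hKa j, fun v hv hvA => ?_, hKadj j⟩⟩
  have hvQ := hQ _ (hKQ j hv)
  simp only [Finset.mem_sdiff, Finset.mem_inter, Finset.mem_union, not_and, not_not] at hvQ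
  rcases hvQ.2 ⟨hvA, hvQ.1⟩ with hvX | hvY
  · exact hXu _ _ (hKQ j hv) _ (hσ j) hvX (haX j)
  · exact absurd (hYu _ _ (hKQ j hv) _ (hψ j) hvY (hbY _) ▸ hv) (hKb j)

/-- If `G` has no tree decomposition with bags of size at most `m`, then it has a minor consisting
of a forest with parent function `p` on `w` vertices and a perfect matching between two disjoint
sets of `n` forest vertices, for `w + n ≤ m + 1`. -/
theorem exists_forest_matching [Fintype V] {G : SimpleGraph V} {m w n : ℕ}
    (h : ¬ G.IsSmallSide m ∅ Finset.univ ∅) (hn : 0 < n) (hw : w + n ≤ m + 1)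
    {p : ℕ → ℕ} (hp : ∀ i, 0 < i → p i < i) {a b : Fin n → ℕ} (ha : Function.Injective a)
    (hb : Function.Injective b) (hab : ∀ i j, a i ≠ b j) (haw : ∀ i, a i < w)
    (hbw : ∀ i, b i < w) :
    ∃ (M : ℕ → Finset V) (ψ : Fin n ≃ Fin n), (∀ i < w, G.IsConnSet (M i)) ∧
      (∀ i < w, ∀ j < w, i ≠ j → Disjoint (M i) (M j)) ∧
      (∀ i < w, 0 < i → ∃ u ∈ M i, ∃ v ∈ M (p i), G.Adj u v) ∧
      ∀ j, ∃ u ∈ M (a j), ∃ v ∈ M (b (ψ j)), G.Adj u v := by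
  have hwm : w ≤ m := by omega
  obtain ⟨L, hL, htop, hor⟩ := exists_closedList hwm h
  obtain ⟨A, B, M, x, hmax, hG⟩ := exists_isGrown hwm hL htop hp le_rfl
  have hroot : ∀ i < w, ∀ j < w, x i ∈ M j → i = j := fun i hi j hj hx => by
    by_contra hij
    exact Finset.disjoint_left.1 (hG.disjoint i hi j hj hij) (hG.root_mem i hi) hx
  have hxinj : ∀ i < w, ∀ j < w, x i = x j → i = j := fun i hi j hj hij =>
    hroot i hi j hj (hij ▸ hG.root_mem j hj)
  obtain ⟨K, ψ, hKd, hK⟩ := hmax.exists_attachments htop hor hw (a := x ∘ a) (b := x ∘ b)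
    (fun i j hij => ha (hxinj _ (haw i) _ (haw j) hij))
    (fun i j hij => hb (hxinj _ (hbw i) _ (hbw j) hij))
    (fun i j hij => hab i j (hxinj _ (haw i) _ (hbw j) hij))
    (fun i => hG.root_mem_inter _ (haw i)) (fun i => hG.root_mem_inter _ (hbw i))
  have : ∀ i, ∃ N : Finset V, (∃ j, a j = i ∧ N = M i ∪ K j) ∨ ((∀ j, a j ≠ i) ∧ N = M i) := by
    intro i
    by_cases hi : ∃ j, a j = i
    · obtain ⟨j, hj⟩ := hi
      exact ⟨_, Or.inl ⟨j, hj, rfl⟩⟩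
    · push Not at hi
      exact ⟨_, Or.inr ⟨hi, rfl⟩⟩
  choose N hN using this
  have hMN : ∀ i, M i ⊆ N i := fun i => by
    rcases hN i with ⟨j, -, h⟩ | ⟨-, h⟩ <;> rw [h]
    exact Finset.subset_union_left
  have hKN : ∀ j, K j ⊆ N (a j) := fun j => by
    rcases hN (a j) with ⟨j', h1, h2⟩ | ⟨h1, -⟩
    · rw [h2, ha h1]
      exact Finset.subset_union_right
    · exact absurd rfl (h1 j)
  have hcross : ∀ i < w, ∀ j, a j ≠ i → ∀ v ∈ K j, v ∉ M i := fun i hi j hij v hv hvM => by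
    rw [(hK j).2.2.1 v hv (hG.subset i hi hvM)] at hvM
    exact hij (hroot _ (haw j) i hi hvM)
  refine ⟨N, ψ, fun i hi => ?_, fun i hi j hj hij => ?_, fun i hi h0 => ?_, fun j => ?_⟩
  · rcases hN i with ⟨j, rfl, h⟩ | ⟨-, h⟩ <;> rw [h]
    · exact (hG.connSet _ hi).union (hK j).1 (hG.root_mem _ hi) (hK j).2.1 (Or.inl rfl)
    · exact hG.connSet i hi
  · refine Finset.disjoint_left.2 fun v hvi hvj => ?_
    have hMd : v ∈ M i → v ∉ M j := fun h => Finset.disjoint_left.1 (hG.disjoint i hi j hj hij) h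
    rcases hN i with ⟨s, hs, h1⟩ | ⟨-, h1⟩ <;> rcases hN j with ⟨t, ht, h2⟩ | ⟨-, h2⟩ <;>
      rw [h1] at hvi <;> rw [h2] at hvj
    · have hst : s ≠ t := fun h => hij (by rw [← hs, ← ht, h])
      rcases Finset.mem_union.1 hvi with hvi | hvi <;> rcases Finset.mem_union.1 hvj with hvj | hvj
      · exact hMd hvi hvj
      · exact hcross i hi t (by omega) v hvj hvi
      · exact hcross j hj s (by omega) v hvi hvj
      · exact Finset.disjoint_left.1 (hKd hst) hvi hvj
    · rcases Finset.mem_union.1 hvi with hvi | hvi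
      · exact hMd hvi hvj
      · exact hcross j hj s (by omega) v hvi hvj
    · rcases Finset.mem_union.1 hvj with hvj | hvj
      · exact hMd hvi hvj
      · exact hcross i hi t (by omega) v hvj hvi
    · exact hMd hvi hvj
  · obtain ⟨u, hu, v, hv, huv⟩ := hG.adj i hi h0
    exact ⟨u, hMN _ hu, v, hMN _ hv, huv⟩
  · obtain ⟨z, hz, hzb⟩ := (hK j).2.2.2
    exact ⟨z, hKN j hz, _, hMN _ (hG.root_mem _ (hbw _)), hzb⟩

end Growth

end SimpleGraph

lemma SimpleGraph.IsSmallSide.treewidth_le {V : Type*} [Fintype V] [DecidableEq V]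
    {G : SimpleGraph V} {m : ℕ} (h : G.IsSmallSide m ∅ Finset.univ ∅) : treewidth G ≤ m - 1 := by
  obtain ⟨-, -, ι, _, t, bag, -, ht, -, hconn, hedge, hcard, -⟩ := h.hasRootedTreeDecomposition
  refine Nat.sInf_le ⟨ι, inferInstance, t, bag, ht, fun v => ?_,
    fun u v huv => hedge u (Finset.mem_univ u) v (Finset.mem_univ v) huv, fun v => ?_,
    fun i => (hcard i).trans (by omega)⟩
  · obtain ⟨i, hi⟩ := (hconn v (Finset.mem_univ v)).1
    exact ⟨i, (Finset.mem_filter.1 hi).2⟩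
  · have hcoe : ((Finset.univ.filter fun i => v ∈ bag i : Finset ι) : Set ι) = {i | v ∈ bag i} := by
      simp
    exact hcoe ▸ (hconn v (Finset.mem_univ v)).connected

/-- If `h > 2` and `tw(G) ≥ (3/2)(3·2^h - 1) - 1`, then `G` contains as a minor the
union of the complete binary tree `B_h` and a path on `2^h` vertices, linked by a
perfect matching (given by some bijection `ψ`) between the leaves of the tree and the
vertices of the path. -/
theorem wheelHost_minor_of_treewidth {V : Type*} [Fintype V] (h : ℕ) (hh : 2 < h)
    (G : SimpleGraph V)
    (htw : (treewidth G : ℝ) ≥ 3 / 2 * (3 * 2 ^ h - 1) - 1) :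
    ∃ ψ : Fin (2 ^ h) ≃ Fin (2 ^ h), IsMinor (wheelHost h ψ) G := by
  classical
  have hpow : 0 < 2 ^ h := by positivity
  have hsucc : 2 ^ (h + 1) = 2 * 2 ^ h := pow_succ' 2 h
  have hnot : ¬ G.IsSmallSide (4 * 2 ^ h - 2) ∅ Finset.univ ∅ := fun hs => by
    have h1 : treewidth G + 3 ≤ 4 * 2 ^ h := by have := hs.treewidth_le; omega
    have h2 : (treewidth G : ℝ) + 3 ≤ 4 * 2 ^ h := by exact_mod_cast h1
    have h3 : (1 : ℝ) ≤ 2 ^ h := by exact_mod_cast hpow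
    linarith
  obtain ⟨M, ψ, hconn, hdisj, hadj, hmatch⟩ := SimpleGraph.exists_forest_matching
    (w := 3 * 2 ^ h - 1) (n := 2 ^ h) hnot hpow (by omega)
    (p := fun i => if i < 2 * 2 ^ h - 1 then (i - 1) / 2 else i - 1)
    (fun i hi => by split_ifs <;> omega)
    (a := fun j => 2 ^ h - 1 + j) (b := fun j => 2 * 2 ^ h - 1 + j)
    (fun i j hij => by dsimp only at hij; omega) (fun i j hij => by dsimp only at hij; omega)
    (fun i j => by have := i.2; omega) (fun i => by have := i.2; omega)
    (fun i => by have := i.2; omega)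
  let idx : Fin (2 ^ (h + 1) - 1) ⊕ Fin (2 ^ h) → ℕ :=
    Sum.elim (fun a => a) (fun i => 2 * 2 ^ h - 1 + i)
  have hidx : ∀ u, idx u < 3 * 2 ^ h - 1 := by
    rintro (a | i)
    · have := a.2
      simp only [idx, Sum.elim_inl]
      omega
    · have := i.2
      simp only [idx, Sum.elim_inr]
      omega
  have hinj : ∀ u v, u ≠ v → idx u ≠ idx v := by
    rintro (a | i) (b | j) huv hi <;> simp only [idx, Sum.elim_inl, Sum.elim_inr] at hi
    · exact huv (by rw [Fin.ext hi])
    · have := a.2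
      omega
    · have := b.2
      omega
    · exact huv (by rw [Fin.ext (Nat.add_left_cancel hi)])
  have hsymm : ∀ i j, (∃ u ∈ M i, ∃ v ∈ M j, G.Adj u v) → ∃ u ∈ M j, ∃ v ∈ M i, G.Adj u v :=
    fun i j ⟨u, hu, v, hv, huv⟩ => ⟨v, hv, u, hu, huv.symm⟩
  have htree : ∀ a b, b < 2 * 2 ^ h - 1 → b = 2 * a + 1 ∨ b = 2 * a + 2 →
      ∃ u ∈ M a, ∃ v ∈ M b, G.Adj u v := by
    intro a b hb hab
    have := hadj b (by omega) (by omega)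
    rw [if_pos hb, show (b - 1) / 2 = a by omega] at this
    exact hsymm _ _ this
  have hpath : ∀ i, i + 1 < 2 ^ h →
      ∃ u ∈ M (2 * 2 ^ h - 1 + i), ∃ v ∈ M (2 * 2 ^ h - 1 + (i + 1)), G.Adj u v := by
    intro i hi
    have := hadj (2 * 2 ^ h - 1 + (i + 1)) (by omega) (by omega)
    rw [if_neg (by omega), Nat.add_sub_assoc (by omega), Nat.add_sub_cancel] at this
    exact hsymm _ _ this
  refine ⟨ψ, fun u => M (idx u), fun u => (hconn _ (hidx u)).connected, fun u v huv =>
    Finset.disjoint_coe.2 (hdisj _ (hidx u) _ (hidx v) (hinj u v huv)), fun u v huv => ?_⟩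
  simp only [wheelHost, SimpleGraph.fromRel_adj] at huv
  rcases u with a | i <;> rcases v with b | j <;>
    simp only [idx, Sum.elim_inl, Sum.elim_inr, Finset.mem_coe]
  · rcases huv.2 with hab | hab
    · exact htree a b (by omega) hab
    · exact hsymm _ _ (htree b a (by omega) hab)
  · obtain ⟨k, hk, rfl⟩ := huv.2.resolve_right id
    rw [hk]
    exact hmatch k
  · obtain ⟨k, hk, rfl⟩ := huv.2.resolve_left id
    rw [hk]
    exact hsymm _ _ (hmatch k)
  · rcases huv.2 with hij | hij
    · rw [hij]
      exact hpath i (by omega)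
    · rw [hij]
      exact hsymm _ _ (hpath j (by omega))
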